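/- The Gray graph is isomorphic to the Levi graph of the 3×3×3 grid configuration: there exists a graph isomorphism between the Gray graph (on vertex set ZMod 54, defined by the LCF notation) and the incidence graph of the 3×3×3 grid. -/

import Mathlib

def lcfD (x : ZMod 6) : ℤ :=
  if x = 0 then 7 else if x = 1 then -7 else if x = 2 then 13
  else if x = 3 then -13 else if x = 4 then 25 else -25

def grayGraph : SimpleGraph (ZMod 54) :=
  SimpleGraph.fromRel (fun u v => v = u + 1 ∨ v = u + ((lcfD ((u.val : ZMod 6))) : ZMod 54))

/-- The coordinates of a point of the `3×3×3` grid other than the `k`-th,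
taken in increasing order of index. -/
def otherCoords (p : Fin 3 × Fin 3 × Fin 3) (k : Fin 3) : Fin 3 × Fin 3 :=
  if k = 0 then (p.2.1, p.2.2) else if k = 1 then (p.1, p.2.2) else (p.1, p.2.1)

/-- The Levi (incidence) graph of the `3×3×3` grid configuration: a point `p` (left summand)
is adjacent to a line `(k, a, b)` (right summand, `k` the axis direction, `a, b` the fixed
values of the other two coordinates in increasing order of index) iff the coordinates of `p`
other than the `k`-th equal `(a, b)`. -/
def gridLevi : SimpleGraph ((Fin 3 × Fin 3 × Fin 3) ⊕ (Fin 3 × Fin 3 × Fin 3)) :=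
  SimpleGraph.fromRel (fun x y =>
    match x, y with
    | Sum.inl p, Sum.inr l => otherCoords p l.1 = (l.2.1, l.2.2)
    | _, _ => False)

instance : DecidableRel grayGraph.Adj := fun u v =>
  decidable_of_iff _ (SimpleGraph.fromRel_adj _ u v).symm

instance : DecidableRel gridLevi.Adj
  | .inl _, .inl _ => .isFalse (by simp [gridLevi])
  | .inr _, .inr _ => .isFalse (by simp [gridLevi])
  | .inl p, .inr l =>
    decidable_of_iff (otherCoords p l.1 = (l.2.1, l.2.2)) (by simp [gridLevi])
  | .inr l, .inl p =>
    decidable_of_iff (otherCoords p l.1 = (l.2.1, l.2.2)) (by simp [gridLevi])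

/-- The point part of an automorphism of order `9` of the `3×3×3` grid. -/
def gridPointRotation (p : Fin 3 × Fin 3 × Fin 3) : Fin 3 × Fin 3 × Fin 3 :=
  (p.2.2 + 1, p.1, p.2.1)

/-- The line part of the automorphism whose point part is `gridPointRotation`. -/
def gridLineRotation (l : Fin 3 × Fin 3 × Fin 3) : Fin 3 × Fin 3 × Fin 3 :=
  if l.1 = 2 then (0, l.2.1, l.2.2) else (l.1 + 1, l.2.2 + 1, l.2.1)

/-- The equivariant map from the Gray graph to the grid that carries the rotation `u ↦ u + 6`
to the automorphism given by `gridPointRotation` and `gridLineRotation`; odd vertices go to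
points and even vertices to lines. -/
def grayToGrid (u : ZMod 54) : (Fin 3 × Fin 3 × Fin 3) ⊕ (Fin 3 × Fin 3 × Fin 3) :=
  match u.val % 6 with
  | 0 => .inr (gridLineRotation^[u.val / 6] (0, 0, 0))
  | 1 => .inl (gridPointRotation^[u.val / 6] (0, 0, 0))
  | 2 => .inr (gridLineRotation^[u.val / 6] (1, 0, 0))
  | 3 => .inl (gridPointRotation^[u.val / 6] (0, 2, 0))
  | 4 => .inr (gridLineRotation^[u.val / 6] (0, 2, 0))
  | _ => .inl (gridPointRotation^[u.val / 6] (1, 2, 0))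

theorem grayToGrid_injective : Function.Injective grayToGrid := by
  decide +kernel

theorem grayToGrid_bijective : Function.Bijective grayToGrid :=
  (Fintype.bijective_iff_injective_and_card grayToGrid).2 ⟨grayToGrid_injective, by simp⟩

theorem gridLevi_adj_grayToGrid_iff :
    ∀ u v : ZMod 54, gridLevi.Adj (grayToGrid u) (grayToGrid v) ↔ grayGraph.Adj u v := by
  decide +kernel

theorem gray_graph_iso_grid_levi : Nonempty (grayGraph ≃g gridLevi) := by
  exact ⟨⟨Equiv.ofBijective grayToGrid grayToGrid_bijective,
    fun {u v} => gridLevi_adj_grayToGrid_iff u v⟩⟩
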